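/- Let K, A, B be groups and let φ_A : K → A and φ_B : K → B be injective group homomorphisms, neither of which is surjective. Let G = A ∗_K B be the amalgamated free product of A and B over K (the pushout of φ_A and φ_B in the category of groups), let ι : K → G be the canonical (injective) homomorphism, and set H = ι(K) ≤ G. Then there exists a nontrivial H-almost invariant subset X ⊆ G that is nested: for every g ∈ G, at least one of the four sets gX ∩ X, gX ∩ (G∖X), g(G∖X) ∩ X, g(G∖X) ∩ (G∖X) is empty. -/

import Mathlib

open Pointwise

variable {G : Type*} [Group G]

/-- A subset `A ⊆ G` is `H`-finite if it is contained in a finite union of right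
cosets `Ht₁ ∪ … ∪ Ht_k` (equivalently, its image in `H\G` is finite). -/
def HFin (H : Subgroup G) (A : Set G) : Prop :=
  ∃ T : Finset G, A ⊆ ⋃ t ∈ T, (H : Set G) * ({t} : Set G)

/-- A subset `X ⊆ G` is `H`-almost invariant if `HX = X` and for every `g ∈ G` the
symmetric difference `X △ Xg` is `H`-finite. -/
def HAlmostInvariant (H : Subgroup G) (X : Set G) : Prop :=
  (H : Set G) * X = X ∧ ∀ g : G, HFin H (symmDiff X (X * ({g} : Set G)))

/-- An `H`-almost invariant set `X` is nontrivial if both `X` and its complement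
`G ∖ X` are `H`-infinite. -/
def HNontrivial (H : Subgroup G) (X : Set G) : Prop :=
  ¬ HFin H X ∧ ¬ HFin H Xᶜ

/-- An `H`-almost invariant set `X ⊆ G` is nested if for every `g ∈ G` at least one
of the four sets `gX ∩ X`, `gX ∩ (G∖X)`, `g(G∖X) ∩ X`, `g(G∖X) ∩ (G∖X)` is empty. -/
def Nested (X : Set G) : Prop :=
  ∀ g : G,
    ({g} : Set G) * X ∩ X = ∅ ∨ ({g} : Set G) * X ∩ Xᶜ = ∅ ∨
    ({g} : Set G) * Xᶜ ∩ X = ∅ ∨ ({g} : Set G) * Xᶜ ∩ Xᶜ = ∅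

open Monoid

section HFinite

variable {H : Subgroup G} {S T : Set G}

theorem hFin_iff : HFin H S ↔ ∃ T : Finset G, ∀ x ∈ S, ∃ t ∈ T, x * t⁻¹ ∈ H := by
  simp [HFin, Set.subset_def]

theorem HFin.mono (hT : HFin H T) (h : S ⊆ T) : HFin H S :=
  let ⟨F, hF⟩ := hT
  ⟨F, h.trans hF⟩

theorem HFin.union (hS : HFin H S) (hT : HFin H T) : HFin H (S ∪ T) := by
  classical
  rw [hFin_iff] at *
  obtain ⟨F, hF⟩ := hS
  obtain ⟨F', hF'⟩ := hT
  refine ⟨F ∪ F', ?_⟩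
  rintro x (hx | hx)
  · obtain ⟨t, ht, h⟩ := hF x hx
    exact ⟨t, Finset.mem_union_left _ ht, h⟩
  · obtain ⟨t, ht, h⟩ := hF' x hx
    exact ⟨t, Finset.mem_union_right _ ht, h⟩

theorem HFin.mul_singleton (hS : HFin H S) (g : G) : HFin H (S * {g}) := by
  classical
  rw [hFin_iff] at *
  obtain ⟨F, hF⟩ := hS
  refine ⟨F.image (· * g), ?_⟩
  rw [Set.mul_singleton]
  rintro _ ⟨x, hx, rfl⟩
  obtain ⟨t, ht, h⟩ := hF x hx
  exact ⟨t * g, Finset.mem_image_of_mem _ ht, by simpa [mul_assoc] using h⟩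

theorem not_hFin_of_pow_mem {c : G} (hc : ∀ n : ℕ, c ^ (n + 1) ∉ H)
    (hS : ∀ n : ℕ, c ^ (n + 1) ∈ S) : ¬ HFin H S := by
  rw [hFin_iff]
  rintro ⟨F, hF⟩
  choose t ht h using fun n => hF _ (hS n)
  have key : ∀ m n : ℕ, m < n → t m ≠ t n := by
    intro m n hmn e
    obtain ⟨d, rfl⟩ := Nat.exists_eq_add_of_lt hmn
    have h' := H.mul_mem (h (m + d + 1)) (H.inv_mem (h m))
    rw [e] at h'
    refine hc d ?_
    rw [show m + d + 1 + 1 = (d + 1) + (m + 1) by omega, pow_add] at h'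
    simpa [mul_assoc] using h'
  obtain ⟨m, n, hne, e⟩ := Finite.exists_ne_map_eq_of_infinite
    (fun n => (⟨t n, ht n⟩ : {x // x ∈ F}))
  have e' : t m = t n := congrArg Subtype.val e
  rcases lt_or_gt_of_ne hne with hlt | hlt
  · exact key _ _ hlt e'
  · exact key _ _ hlt e'.symm

/-- The elements moving `S` by an `H`-finite amount form a subgroup. -/
def almostStabilizer (H : Subgroup G) (S : Set G) : Subgroup G where
  carrier := {g | HFin H (symmDiff S (S * {g}))}
  one_mem' := ⟨∅, by simp⟩
  mul_mem' {a b} ha hb := by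
    refine (hb.union (HFin.mul_singleton ha b)).mono ?_
    intro x
    simp only [Set.mem_symmDiff, Set.mem_union, Set.mul_singleton, Set.image_mul_right,
      Set.mem_preimage, mul_inv_rev, mul_assoc]
    tauto
  inv_mem' {a} ha := by
    refine (HFin.mul_singleton ha a⁻¹).mono ?_
    intro x
    simp only [Set.mem_symmDiff, Set.mul_singleton, Set.image_mul_right,
      Set.mem_preimage, inv_inv, mul_inv_cancel_right]
    tauto

end HFinite

/-- `IsAlternating K M i j g` says that `g` is a product of elements of `M i ∖ K`, `M (!i) ∖ K`, …,
`M j ∖ K`, with consecutive factors taken alternately from `M true` and `M false`. -/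
inductive IsAlternating (K : Subgroup G) (M : Bool → Subgroup G) : Bool → Bool → G → Prop
  | single {i : Bool} {u : G} (hu : u ∈ M i) (hK : u ∉ K) : IsAlternating K M i i u
  | cons {i j : Bool} {u g : G} (hu : u ∈ M i) (hK : u ∉ K) (hg : IsAlternating K M (!i) j g) :
      IsAlternating K M i j (u * g)

namespace IsAlternating

variable {K : Subgroup G} {M : Bool → Subgroup G} {i j l : Bool} {g h k u : G}

theorem mul (hg : IsAlternating K M i j g) (hh : IsAlternating K M (!j) l h) :
    IsAlternating K M i l (g * h) := by
  induction hg with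
  | single hu hK => exact cons hu hK hh
  | cons hu hK _ ih => rw [mul_assoc]; exact cons hu hK (ih hh)

theorem inv (hg : IsAlternating K M i j g) : IsAlternating K M j i g⁻¹ := by
  induction hg with
  | single hu hK => exact single (inv_mem hu) (by simpa using hK)
  | @cons i j u g hu hK _ ih =>
    rw [mul_inv_rev]
    refine ih.mul ?_
    rw [Bool.not_not]
    exact single (inv_mem hu) (by simpa using hK)

theorem base_mul (hM : ∀ i, K ≤ M i) (hk : k ∈ K) (hg : IsAlternating K M i j g) :
    IsAlternating K M i j (k * g) := by
  cases hg with
  | single hu hK =>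
    exact single (mul_mem (hM _ hk) hu) (by rwa [Subgroup.mul_mem_cancel_left _ hk])
  | cons hu hK hg =>
    rw [← mul_assoc]
    exact cons (mul_mem (hM _ hk) hu) (by rwa [Subgroup.mul_mem_cancel_left _ hk]) hg

theorem mul_base (hM : ∀ i, K ≤ M i) (hk : k ∈ K) (hg : IsAlternating K M i j g) :
    IsAlternating K M i j (g * k) := by
  simpa using (hg.inv.base_mul hM (inv_mem hk)).inv

theorem factor_mul (hM : ∀ i, K ≤ M i) (hu : u ∈ M i) (hg : IsAlternating K M l j g) :
    (∃ l', IsAlternating K M l' j (u * g)) ∨ u * g ∈ K := by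
  by_cases huK : u ∈ K
  · exact .inl ⟨l, hg.base_mul hM huK⟩
  by_cases hil : l = i
  · subst hil
    cases hg with
    | single hv hK =>
      by_cases huv : u * g ∈ K
      · exact .inr huv
      · exact .inl ⟨_, single (mul_mem hu hv) huv⟩
    | @cons _ _ v g' hv hK hg =>
      left
      rw [← mul_assoc]
      by_cases huv : u * v ∈ K
      · exact ⟨_, hg.base_mul hM huv⟩
      · exact ⟨_, cons (mul_mem hu hv) huv hg⟩
  · obtain rfl : l = !i := Bool.eq_not.2 hil
    exact .inl ⟨_, cons hu huK hg⟩

theorem mul_factor (hM : ∀ i, K ≤ M i) (hu : u ∈ M i) (hg : IsAlternating K M j l g) :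
    (∃ l', IsAlternating K M j l' (g * u)) ∨ g * u ∈ K := by
  rcases hg.inv.factor_mul hM (inv_mem hu) with ⟨l', h⟩ | h
  · exact .inl ⟨l', by simpa using h.inv⟩
  · exact .inr (by simpa using inv_mem h)

theorem pow (hg : IsAlternating K M i (!i) g) (n : ℕ) : IsAlternating K M i (!i) (g ^ (n + 1)) := by
  induction n with
  | zero => simpa using hg
  | succ n ih => rw [pow_succ]; exact ih.mul (by simpa using hg)

theorem mem_or_exists (hM : ∀ i, K ≤ M i) (hgen : M true ⊔ M false = ⊤) (g : G) :
    g ∈ K ∨ ∃ i j, IsAlternating K M i j g := by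
  have step : ∀ (i : Bool) (u : G), u ∈ M i → ∀ x : G,
      (x ∈ K ∨ ∃ i j, IsAlternating K M i j x) → (u * x ∈ K ∨ ∃ i j, IsAlternating K M i j (u * x)) := by
    rintro i u hu x (hx | ⟨l, j, hx⟩)
    · by_cases h : u * x ∈ K
      · exact .inl h
      · exact .inr ⟨i, i, single (mul_mem hu (hM i hx)) h⟩
    · rcases hx.factor_mul hM hu with ⟨l', h⟩ | h
      · exact .inr ⟨_, _, h⟩
      · exact .inl h
  have hg : g ∈ Subgroup.closure ((M true : Set G) ∪ M false) := by
    rw [← Subgroup.sup_eq_closure, hgen]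
    trivial
  have step' : ∀ u ∈ (M true : Set G) ∪ M false, ∃ i, u ∈ M i := by
    rintro u (hu | hu)
    exacts [⟨_, hu⟩, ⟨_, hu⟩]
  induction hg using Subgroup.closure_induction_left with
  | one => exact .inl (one_mem K)
  | mul_left u hu x _ ih =>
    obtain ⟨i, hi⟩ := step' u hu
    exact step i u hi x ih
  | inv_mul_cancel u hu x _ ih =>
    obtain ⟨i, hi⟩ := step' u hu
    exact step i _ (inv_mem hi) x ih

end IsAlternating

/-- A group generated by two subgroups `M true` and `M false` properly containing `K`, in which no
reduced product lies in `K`, has a nested nontrivial `K`-almost invariant subset: the elements with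
a reduced expression starting in `M true`. -/
theorem exists_nested_of_isAlternating_notMem (K : Subgroup G) (M : Bool → Subgroup G)
    (hM : ∀ i, K ≤ M i) (hgen : M true ⊔ M false = ⊤) (hne : ∀ i, ∃ u ∈ M i, u ∉ K)
    (hred : ∀ i j g, IsAlternating K M i j g → g ∉ K) :
    ∃ X : Set G, HAlmostInvariant K X ∧ HNontrivial K X ∧ Nested X := by
  set X : Set G := {g | ∃ j, IsAlternating K M true j g}
  have hdisj : ∀ {j g}, IsAlternating K M false j g → g ∉ X := by
    rintro j g hg ⟨l, hg'⟩
    exact hred _ _ _ (hg'.inv.mul (l := j) hg) (by simp)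
  have hcompl : ∀ {g}, g ∉ X → g ∈ K ∨ ∃ j, IsAlternating K M false j g := by
    intro g hg
    rcases IsAlternating.mem_or_exists hM hgen g with h | ⟨i, j, h⟩
    · exact .inl h
    · cases i
      · exact .inr ⟨j, h⟩
      · exact absurd ⟨j, h⟩ hg
  have hfst : ∀ {i g x}, IsAlternating K M i true g → x ∉ X → ∃ l, IsAlternating K M i l (g * x) := by
    intro i g x hg hx
    rcases hcompl hx with hx | ⟨l, hx⟩
    · exact ⟨_, hg.mul_base hM hx⟩
    · exact ⟨_, hg.mul hx⟩
  obtain ⟨a, ha, haK⟩ := hne true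
  obtain ⟨b, hb, hbK⟩ := hne false
  have hab : IsAlternating K M true false (a * b) := .cons ha haK (.single hb hbK)
  have hba : IsAlternating K M false true (b * a) := .cons hb hbK (.single ha haK)
  refine ⟨X, ⟨?_, fun g => ?_⟩, ⟨?_, ?_⟩, fun g => ?_⟩
  · refine Set.Subset.antisymm ?_ fun x hx => ⟨1, one_mem K, x, hx, one_mul x⟩
    rintro _ ⟨k, hk, x, ⟨j, hx⟩, rfl⟩
    exact ⟨j, hx.base_mul hM hk⟩
  · suffices h : ∀ i, M i ≤ almostStabilizer K X by
      have : (⊤ : Subgroup G) ≤ almostStabilizer K X := hgen ▸ sup_le (h true) (h false)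
      exact this (Subgroup.mem_top g)
    intro i u hu
    classical
    refine hFin_iff.2 ⟨{1, u}, ?_⟩
    simp only [Set.mem_symmDiff, Set.mul_singleton, Set.image_mul_right, Set.mem_preimage]
    rintro x (⟨⟨j, hx⟩, hxu⟩ | ⟨⟨j, hx⟩, hxu⟩)
    · rcases hx.mul_factor hM (inv_mem hu) with h | h
      · exact absurd h hxu
      · exact ⟨u, by simp, h⟩
    · rcases hx.mul_factor hM hu with h | h
      · simp only [inv_mul_cancel_right] at h
        exact absurd h hxu
      · exact ⟨1, by simp, by simpa using h⟩
  · exact not_hFin_of_pow_mem (fun n => hred _ _ _ (hab.pow n)) fun n => ⟨_, hab.pow n⟩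
  · exact not_hFin_of_pow_mem (fun n => hred _ _ _ (hba.pow n)) fun n => hdisj (hba.pow n)
  · simp only [Set.eq_empty_iff_forall_notMem, Set.singleton_mul, Set.image_mul_left,
      Set.mem_inter_iff, Set.mem_preimage, Set.mem_compl_iff, not_and, not_not]
    rcases IsAlternating.mem_or_exists hM hgen g with hg | ⟨i, j, hg⟩
    · right; left
      rintro x ⟨j, hx⟩
      exact ⟨j, by simpa using hx.base_mul hM hg⟩
    · cases i <;> cases j
      · left
        rintro x ⟨l, hx⟩
        exact hdisj (by simpa using hg.mul hx)
      · right; right; left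
        intro x hx
        obtain ⟨l, h⟩ := hfst hg hx
        exact hdisj (by simpa using h)
      · right; left
        rintro x ⟨l, hx⟩
        exact ⟨l, by simpa using hg.mul hx⟩
      · right; right; right
        intro x hx
        obtain ⟨l, h⟩ := hfst hg hx
        exact ⟨l, by simpa using h⟩

section Pushout

variable {K : Type*} {F : Bool → Type*} [Group K] [∀ i, Group (F i)] {φ : ∀ i, K →* F i}
  {ι : ∀ i, F i →* G} {f : G →* PushoutI φ} {H : Subgroup G}

theorem IsAlternating.exists_word (hf : ∀ i x, f (ι i x) = PushoutI.of i x)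
    (hH : ∀ i k, ι i (φ i k) ∈ H) {i j : Bool} {g : G}
    (hg : IsAlternating H (fun i => (ι i).range) i j g) :
    ∃ w : CoprodI.Word F, PushoutI.Reduced φ w ∧ w.fstIdx = some i ∧
      PushoutI.ofCoprodI w.prod = f g := by
  have hrange : ∀ {i} {x : F i}, ι i x ∉ H → x ∉ (φ i).range := by
    rintro i _ hx ⟨k, rfl⟩
    exact hx (hH i k)
  have hcons : ∀ {i} {x : F i} (w : CoprodI.Word F), ι i x ∉ H → PushoutI.Reduced φ w →
      w.fstIdx ≠ some i → ∃ w' : CoprodI.Word F, PushoutI.Reduced φ w' ∧ w'.fstIdx = some i ∧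
        PushoutI.ofCoprodI (φ := φ) w'.prod = f (ι i x) * PushoutI.ofCoprodI w.prod := by
    intro i x w hx hw hi
    refine ⟨CoprodI.Word.cons x w hi ?_, ?_, ?_, ?_⟩
    · rintro rfl
      exact hx (by simp)
    · intro y hy
      rcases List.mem_cons.1 hy with rfl | hy
      · exact hrange hx
      · exact hw y hy
    · simp [CoprodI.Word.fstIdx, CoprodI.Word.cons]
    · simp [hf]
  induction hg with
  | single hu hK =>
    obtain ⟨x, rfl⟩ := hu
    obtain ⟨w, h₁, h₂, h₃⟩ := hcons .empty hK (fun _ h => by simp [CoprodI.Word.empty] at h)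
      (by simp [CoprodI.Word.fstIdx, CoprodI.Word.empty])
    exact ⟨w, h₁, h₂, by simpa using h₃⟩
  | cons hu hK _ ih =>
    obtain ⟨x, rfl⟩ := hu
    obtain ⟨w, hw, hi, hp⟩ := ih
    obtain ⟨w', h₁, h₂, h₃⟩ := hcons w hK hw (by simp [hi])
    exact ⟨w', h₁, h₂, by rw [h₃, hp, map_mul]⟩

theorem IsAlternating.notMem (hφ : ∀ i, Function.Injective (φ i))
    (hf : ∀ i x, f (ι i x) = PushoutI.of i x) (hH : ∀ i, ((ι i).comp (φ i)).range = H)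
    {i j : Bool} {g : G} (hg : IsAlternating H (fun i => (ι i).range) i j g) : g ∉ H := by
  intro hgH
  obtain ⟨w, hw, hi, hp⟩ := hg.exists_word hf fun i k => hH i ▸ ⟨k, rfl⟩
  obtain ⟨k, rfl⟩ : g ∈ ((ι i).comp (φ i)).range := by rwa [hH]
  have := hw.eq_empty_of_mem_range hφ
    ⟨k, by rw [hp, MonoidHom.comp_apply, hf, PushoutI.of_apply_eq_base]⟩
  simp [this, CoprodI.Word.fstIdx, CoprodI.Word.empty] at hi

theorem exists_nested_of_hom_pushoutI (hφ : ∀ i, Function.Injective (φ i))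
    (hns : ∀ i, ¬ Function.Surjective (φ i)) (hf : ∀ i x, f (ι i x) = PushoutI.of i x)
    (hH : ∀ i, ((ι i).comp (φ i)).range = H) (hgen : (ι true).range ⊔ (ι false).range = ⊤) :
    ∃ X : Set G, HAlmostInvariant H X ∧ HNontrivial H X ∧ Nested X := by
  refine exists_nested_of_isAlternating_notMem H (fun i => (ι i).range) (fun i => ?_) hgen
    (fun i => ?_) fun i j g hg => hg.notMem hφ hf hH
  · rw [← hH i]
    rintro _ ⟨k, rfl⟩
    exact ⟨φ i k, rfl⟩
  · obtain ⟨x, hx⟩ := not_forall.1 (hns i)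
    refine ⟨ι i x, ⟨x, rfl⟩, fun h => hx ?_⟩
    rw [← hH i] at h
    obtain ⟨k, hk⟩ := h
    refine ⟨k, PushoutI.of_injective hφ i ?_⟩
    rw [← hf, ← hf, ← hk, MonoidHom.comp_apply]

end Pushout

/-- The family form of the main theorem: the pushout, given by its universal property, of two
non-surjective injections `φ true` and `φ false`. -/
theorem exists_nested_of_isPushout.{u} {K GG : Type u} {F : Bool → Type u} [Group K] [Group GG]
    [∀ i, Group (F i)] (φ : ∀ i, K →* F i) (ι : ∀ i, F i →* GG)
    (hφ : ∀ i, Function.Injective (φ i)) (hns : ∀ i, ¬ Function.Surjective (φ i))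
    (hsq : (ι true).comp (φ true) = (ι false).comp (φ false))
    (huniv : ∀ (P : Type u) [Group P] (fA : F true →* P) (fB : F false →* P),
      fA.comp (φ true) = fB.comp (φ false) →
        ∃! f : GG →* P, f.comp (ι true) = fA ∧ f.comp (ι false) = fB) :
    ∃ X : Set GG,
      HAlmostInvariant ((ι true).comp (φ true)).range X ∧
      HNontrivial ((ι true).comp (φ true)).range X ∧
      Nested X := by
  have hgen : (ι true).range ⊔ (ι false).range = ⊤ := by
    set S := (ι true).range ⊔ (ι false).range
    let jA : F true →* S := 
      (ι true).codRestrict S fun a => le_sup_left (a := (ι true).range) ⟨a, rfl⟩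
    let jB : F false →* S := 
      (ι false).codRestrict S fun b => le_sup_right (b := (ι false).range) ⟨b, rfl⟩
    obtain ⟨r, ⟨hrA, hrB⟩, -⟩ := huniv S jA jB (by
      ext k
      exact DFunLike.congr_fun hsq k)
    have hid : S.subtype.comp r = MonoidHom.id GG := by
      refine (huniv GG (ι true) (ι false) hsq).unique ⟨?_, ?_⟩ ⟨rfl, rfl⟩
      · rw [MonoidHom.comp_assoc, hrA]
        rfl
      · rw [MonoidHom.comp_assoc, hrB]
        rfl
    rw [eq_top_iff]
    intro g _
    have h : (r g : GG) = g := DFunLike.congr_fun hid g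
    exact h ▸ (r g).2
  obtain ⟨f, ⟨hf₁, hf₂⟩, -⟩ := huniv (PushoutI φ) (PushoutI.of true) (PushoutI.of false)
    ((PushoutI.of_comp_eq_base true).trans (PushoutI.of_comp_eq_base false).symm)
  refine exists_nested_of_hom_pushoutI (f := f) hφ hns ?_ ?_ hgen
  · rintro (_ | _) x
    exacts [DFunLike.congr_fun hf₂ x, DFunLike.congr_fun hf₁ x]
  · rintro (_ | _)
    exacts [congrArg MonoidHom.range hsq.symm, rfl]

/-- Let `K, A, B` be groups and `φ_A : K → A`, `φ_B : K → B`
injective group homomorphisms, neither of which is surjective. Let `G = A ∗_K B` be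
the amalgamated free product of `A` and `B` over `K` — i.e. the pushout of `φ_A`
and `φ_B` in the category of groups, here characterised by its universal property —
with canonical homomorphisms `ι_A : A → G`, `ι_B : B → G`, `ι = ι_A ∘ φ_A : K → G`,
and set `H = ι(K) ≤ G`. Then there exists a nontrivial `H`-almost invariant subset
`X ⊆ G` that is nested. -/
theorem stmt_10.{u} {K A B GG : Type u} [Group K] [Group A] [Group B] [Group GG]
    (φA : K →* A) (φB : K →* B)
    (hφAinj : Function.Injective φA) (hφBinj : Function.Injective φB)
    (hφAns : ¬ Function.Surjective φA) (hφBns : ¬ Function.Surjective φB)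
    (ιA : A →* GG) (ιB : B →* GG)
    (hsq : ιA.comp φA = ιB.comp φB)
    (huniv : ∀ (P : Type u) [Group P] (fA : A →* P) (fB : B →* P),
      fA.comp φA = fB.comp φB →
        ∃! f : GG →* P, f.comp ιA = fA ∧ f.comp ιB = fB) :
    ∃ X : Set GG,
      HAlmostInvariant (ιA.comp φA).range X ∧
      HNontrivial (ιA.comp φA).range X ∧
      Nested X := by
  let _ : ∀ i, Group (cond i A B) := Bool.rec ‹Group B› ‹Group A›
  let φ : ∀ i, K →* cond i A B := Bool.rec φB φA
  let ι : ∀ i, cond i A B →* GG := Bool.rec ιB ιA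
  have hφ : ∀ i, Function.Injective (φ i) := Bool.rec hφBinj hφAinj
  have hns : ∀ i, ¬ Function.Surjective (φ i) := Bool.rec hφBns hφAns
  exact exists_nested_of_isPushout φ ι hφ hns hsq huniv
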